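/- Let H be a group and a, b ∈ H. For every n ∈ ℕ, the set (a, b^{±1})_n of n-fold iterated commutators is contained in the subgroup ⟨a^{b^l} : l = −n, …, n⟩ generated by the conjugates b^{−l} a b^{l} with |l| ≤ n. -/

import Mathlib

/-- The commutator `[x,y] = x⁻¹y⁻¹xy` (the convention used in the paper). -/
def pComm {G : Type*} [Group G] (x y : G) : G := x⁻¹ * y⁻¹ * x * y

/-- The sets `(a, b^{±1})_n` of iterated commutators:
`(a, b^{±1})_1 = {[a,b], [a,b⁻¹]}` and
`(a, b^{±1})_{n+1} = {[c,b], [c,b⁻¹] : c ∈ (a, b^{±1})_n}`. Here `iterComm a b 0 = {a}`,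
so `iterComm a b n` is `(a, b^{±1})_n` for `n ≥ 1`. -/
def iterComm {G : Type*} [Group G] (a b : G) : ℕ → Set G
  | 0 => {a}
  | n + 1 => {x | ∃ c ∈ iterComm a b n, x = pComm c b ∨ x = pComm c b⁻¹}

/-- The subgroup generated by the conjugates `b⁻ˡ a bˡ` with `|l| ≤ n`. -/
def closureConj {H : Type*} [Group H] (a b : H) (n : ℕ) : Subgroup H :=
  Subgroup.closure {x : H | ∃ l : ℤ, |l| ≤ (n : ℤ) ∧ x = (b ^ l)⁻¹ * a * b ^ l}

theorem conj_zpow_mem_closureConj {H : Type*} [Group H] {a b c : H} {m n : ℕ} {k : ℤ}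
    (hk : |k| + m ≤ n) (hc : c ∈ closureConj a b m) :
    (b ^ k)⁻¹ * c * b ^ k ∈ closureConj a b n := by
  have hle : closureConj a b m ≤
      (closureConj a b n).comap (MulAut.conj (b ^ k)⁻¹).toMonoidHom := by
    refine (Subgroup.closure_le _).2 ?_
    rintro _ ⟨l, hl, rfl⟩
    refine Subgroup.subset_closure ⟨l + k, (abs_add_le l k).trans (by lia), ?_⟩
    simp only [MulEquiv.coe_toMonoidHom, MulAut.conj_apply]
    group
  have h := hle hc
  simpa only [Subgroup.mem_comap, MulEquiv.coe_toMonoidHom, MulAut.conj_apply, inv_inv] using h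

theorem pComm_zpow_mem_closureConj {H : Type*} [Group H] {a b c : H} {m n : ℕ} {k : ℤ}
    (hk : |k| + m ≤ n) (hc : c ∈ closureConj a b m) :
    pComm c (b ^ k) ∈ closureConj a b n := by
  have hc' : c ∈ closureConj a b n := by
    simpa using conj_zpow_mem_closureConj (n := n) (k := 0)
      (by have := abs_nonneg k; simp only [abs_zero]; lia) hc
  simpa [pComm, mul_assoc] using
    mul_mem (inv_mem hc') (conj_zpow_mem_closureConj hk hc)

theorem iterComm_subset_closureConj {H : Type*} [Group H] (a b : H) (n : ℕ) :
    iterComm a b n ⊆ closureConj a b n := by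
  induction n with
  | zero =>
    rintro _ rfl
    exact Subgroup.subset_closure ⟨0, by simp, by simp⟩
  | succ n ih =>
    rintro _ ⟨c, hc, rfl | rfl⟩
    · simpa using pComm_zpow_mem_closureConj (n := n + 1) (k := 1)
        (by simp [add_comm]) (ih hc)
    · simpa using pComm_zpow_mem_closureConj (n := n + 1) (k := -1)
        (by simp [add_comm]) (ih hc)

/-- **Lemma 5.2 (Osin).** For any group `H` and `a, b ∈ H`, the set `(a, b^{±1})_n` is
contained in the subgroup generated by the conjugates `a^{b^l} = b⁻ˡ a bˡ` with `|l| ≤ n`. -/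
theorem iterComm_subset_closure_conjugates
    {H : Type*} [Group H] (a b : H) (n : ℕ) (hn : 1 ≤ n) :
    iterComm a b n ⊆
      ↑(Subgroup.closure {x : H | ∃ l : ℤ, |l| ≤ (n : ℤ) ∧ x = (b ^ l)⁻¹ * a * b ^ l}) :=
  iterComm_subset_closureConj a b n
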